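/- Every infinite subset A of Σ either is dominated or contains a fan. In particular, if T is a downwards closed, well-founded, infinite subtree of Σ, then every infinite subset A of T contains a fan. -/

import Mathlib

open Set

/- Here the tree `Σ` of strictly increasing finite sequences of naturals is modelled by
those `l : List ℕ` with `l.Sorted (· < ·)`, ordered by end-extension (list prefix). -/

/-- A set of finite sequences is dominated if there is `σ : ℕ → ℕ` with
`t i < σ i` for every member `t` and every `i < |t|`. -/
def Dominated (A : Set (List ℕ)) : Prop :=
  ∃ σ : ℕ → ℕ, ∀ t ∈ A, ∀ i : ℕ, ∀ h : i < t.length, t.get ⟨i, h⟩ < σ i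

/-- A fan: an infinite set `F ⊆ Σ` which can be enumerated as `{t_n : n ∈ ℕ}` so that
for some `s ∈ Σ` and some strictly increasing `(m_n)` with `s < {m_0}` we have
`s ∪ {m_n} ⊑ t_n` for all `n`. -/
def IsFan (F : Set (List ℕ)) : Prop :=
  ∃ t : ℕ → List ℕ, Function.Injective t ∧ F = Set.range t ∧
    ∃ s : List ℕ, s.Pairwise (· < ·) ∧
      ∃ m : ℕ → ℕ, StrictMono m ∧ (∀ a ∈ s, a < m 0) ∧
        ∀ n : ℕ, (s ++ [m n]) <+: t n


/-- The immediate successors of `s` in the tree generated by `A`. -/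
def succs (A : Set (List ℕ)) (s : List ℕ) : Set ℕ := {m | ∃ t ∈ A, (s ++ [m]) <+: t}

lemma fan_of_infinite (A : Set (List ℕ)) (hA : ∀ l ∈ A, l.Pairwise (· < ·)) (s : List ℕ)
    (h : (succs A s).Infinite) : ∃ F ⊆ A, IsFan F := by
  have hm : ∀ n, ∃ t ∈ A, (s ++ [Nat.nth (· ∈ succs A s) n]) <+: t :=
    fun n => Nat.nth_mem_of_infinite h n
  choose t htA ht using hm
  have hmono : StrictMono (Nat.nth (· ∈ succs A s)) := Nat.nth_strictMono h
  have hp := (hA _ (htA 0)).sublist (ht 0).sublist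
  rw [List.pairwise_append] at hp
  refine ⟨Set.range t, ?_, t, ?_, rfl, s, hp.1, _, hmono, ?_, ht⟩
  · rintro _ ⟨n, rfl⟩
    exact htA n
  · intro a b hab
    have h1 := ht a
    rw [hab] at h1
    have h2 := ht b
    have h3 := (List.prefix_of_prefix_length_le h1 h2 (by simp)).eq_of_length (by simp)
    have h4 : Nat.nth (· ∈ succs A s) a = Nat.nth (· ∈ succs A s) b := by simpa using h3
    exact hmono.injective h4
  · intro a ha
    exact hp.2.2 a ha _ (by simp)

lemma take_succ_prefix (t : List ℕ) (i : ℕ) (h : i < t.length) :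
    (t.take i ++ [t[i]]) <+: t := by
  rw [List.take_append_getElem]
  exact List.take_prefix _ _

lemma dominated_of_finite (A : Set (List ℕ)) (h : ∀ s, (succs A s).Finite) : Dominated A := by
  have hP : ∀ n, {s : List ℕ | s.length = n ∧ ∃ t ∈ A, s <+: t}.Finite := by
    intro n
    induction n with
    | zero => exact (Set.finite_singleton []).subset (by rintro s ⟨hs, -⟩; simpa using hs)
    | succ n ih =>
      refine (ih.biUnion (fun s _ => (h s).image (fun m => s ++ [m]))).subset ?_
      rintro s ⟨hs, t, ht, hst⟩
      have hn : n < s.length := by omega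
      have e : s.take n ++ [s[n]] = s := by
        rw [List.take_append_getElem, ← hs, List.take_length]
      simp only [Set.mem_iUnion]
      refine ⟨s.take n, ⟨by simp [hs], t, ht, (List.take_prefix _ _).trans hst⟩, s[n],
        ⟨t, ht, by rw [e]; exact hst⟩, e⟩
  have hB : ∀ i, BddAbove (⋃ s ∈ {s : List ℕ | s.length = i ∧ ∃ t ∈ A, s <+: t}, succs A s) :=
    fun i => ((hP i).biUnion (fun s _ => h s)).bddAbove
  choose b hb using hB
  refine ⟨fun i => b i + 1, fun t ht i hi => Nat.lt_succ_of_le (hb i ?_)⟩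
  simp only [Set.mem_iUnion]
  exact ⟨t.take i, ⟨by simp; omega, t, ht, List.take_prefix _ _⟩, t, ht,
    take_succ_prefix t i hi⟩

lemma branch_step (A : Set (List ℕ)) (h : ∀ s, (succs A s).Finite) (s : List ℕ)
    (hs : {t ∈ A | s <+: t}.Infinite) : ∃ m, {t ∈ A | (s ++ [m]) <+: t}.Infinite := by
  by_contra! hc
  apply hs
  refine ((Set.finite_singleton s).union ((h s).biUnion
    (fun m _ => hc m))).subset ?_
  rintro t ⟨ht, u, rfl⟩
  cases u with
  | nil => left; simp
  | cons m u =>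
    right
    simp only [Set.mem_iUnion]
    have hp : (s ++ [m]) <+: (s ++ m :: u) := ⟨u, by simp⟩
    exact ⟨m, ⟨_, ht, hp⟩, ht, hp⟩

lemma exists_branch (A : Set (List ℕ)) (hA : A.Infinite) (h : ∀ s, (succs A s).Finite) :
    ∃ σ : ℕ → ℕ, ∀ n : ℕ, ∃ t ∈ A, (List.ofFn fun i : Fin n => σ i) <+: t := by
  choose f hf using branch_step A h
  let g : ℕ → {s : List ℕ // {t ∈ A | s <+: t}.Infinite} := fun n =>
    Nat.rec ⟨[], by simpa using hA⟩ (fun _ s => ⟨s.1 ++ [f s.1 s.2], hf s.1 s.2⟩) n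
  refine ⟨fun n => f (g n).1 (g n).2, fun n => ?_⟩
  have e : (List.ofFn fun i : Fin n => f (g i).1 (g i).2) = (g n).1 := by
    induction n with
    | zero => simp [g]
    | succ n ih =>
      rw [List.ofFn_succ', List.concat_eq_append]
      simp only [Fin.val_castSucc, Fin.val_last]
      rw [ih]
  rw [e]
  obtain ⟨t, ht⟩ := (g n).2.nonempty
  exact ⟨t, ht.1, ht.2⟩

theorem stmt18 :
    (∀ A : Set (List ℕ), (∀ l ∈ A, l.Pairwise (· < ·)) → A.Infinite →
      Dominated A ∨ ∃ F ⊆ A, IsFan F) ∧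
    (∀ T : Set (List ℕ), (∀ l ∈ T, l.Pairwise (· < ·)) →
      (∀ l ∈ T, ∀ l' : List ℕ, l' <+: l → l' ∈ T) → T.Infinite →
      (¬ ∃ σ : ℕ → ℕ, ∀ n : ℕ, (List.ofFn fun i : Fin n => σ i) ∈ T) →
      ∀ A ⊆ T, A.Infinite → ∃ F ⊆ A, IsFan F) := by
  constructor
  · intro A hA _
    by_cases h : ∀ s, (succs A s).Finite
    · exact Or.inl (dominated_of_finite A h)
    · push Not at h
      obtain ⟨s, hs⟩ := h
      exact Or.inr (fan_of_infinite A hA s hs)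
  · intro T hT hcl _ hwf A hAT hA
    by_cases h : ∀ s, (succs A s).Finite
    · obtain ⟨σ, hσ⟩ := exists_branch A hA h
      refine absurd ⟨σ, fun n => ?_⟩ hwf
      obtain ⟨t, ht, hp⟩ := hσ n
      exact hcl t (hAT ht) _ hp
    · push Not at h
      obtain ⟨s, hs⟩ := h
      exact fan_of_infinite A (fun l hl => hT l (hAT hl)) s hs
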